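/- Let R be a ring satisfying a polynomial identity (a PI ring), let σ be a locally torsion automorphism of R, and let D be a σ-derivation on R. Then J(R[x;σ,D]) ∩ R is a nil ideal of R. -/

import Mathlib

/-- `S` is (a copy of) the Ore extension `R[x;σ,D]` of `R`: `ι : R → S` is the inclusion of
coefficients, `X ∈ S` is the variable, every element of `S` is uniquely a polynomial
`Σᵢ ι(aᵢ) * Xⁱ`, and multiplication is governed by `X * a = σ(a) * X + D(a)`. -/
structure IsOreExtension {R S : Type*} [Ring R] [Ring S]
    (σ : R → R) (D : R → R) (ι : R → S) (X : S) : Prop where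
  σ_add : ∀ a b : R, σ (a + b) = σ a + σ b
  σ_mul : ∀ a b : R, σ (a * b) = σ a * σ b
  σ_one : σ 1 = 1
  D_add : ∀ a b : R, D (a + b) = D a + D b
  D_mul : ∀ a b : R, D (a * b) = σ a * D b + D a * b
  ι_add : ∀ a b : R, ι (a + b) = ι a + ι b
  ι_mul : ∀ a b : R, ι (a * b) = ι a * ι b
  ι_one : ι 1 = 1
  X_comm : ∀ a : R, X * ι a = ι (σ a) * X + ι (D a)
  repr : ∀ s : S, ∃ c : ℕ →₀ R, s = c.sum fun i a => ι a * X ^ i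
  uniq : ∀ c : ℕ →₀ R, (c.sum fun i a => ι a * X ^ i) = 0 → c = 0

/-- `R` satisfies a polynomial identity: there is a nonzero noncommutative polynomial with
integer coefficients, having coefficient `1` on some monomial of maximal degree, which vanishes
under every substitution of elements of `R`. -/
def SatisfiesPolynomialIdentity (R : Type*) [Ring R] : Prop :=
  ∃ (n : ℕ) (f : FreeMonoid (Fin n) →₀ ℤ),
    (∃ w : FreeMonoid (Fin n), f w = 1 ∧
      ∀ w' : FreeMonoid (Fin n), f w' ≠ 0 →
        (FreeMonoid.toList w').length ≤ (FreeMonoid.toList w).length) ∧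
    ∀ v : Fin n → R, (f.sum fun w c => c • ((FreeMonoid.toList w).map v).prod) = 0

section

open Polynomial

/-- A multilinear polynomial identity of degree `d` on `A`, in the variables `y 0, …, y (d - 1)`:
every monomial is a rearrangement of `y 0 * ⋯ * y (d - 1)`, which has coefficient `1`. -/
structure IsMultilinearIdentity (A : Type*) [Ring A] (d : ℕ) (F : List ℕ →₀ ℤ) : Prop where
  perm : ∀ l, F l ≠ 0 → l.Perm (List.range d)
  coeff_range : F (List.range d) = 1
  vanish : ∀ y : ℕ → A, (F.sum fun l c => c • (l.map y).prod) = 0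

theorem List.prod_ofFn_sum {R : Type*} [Ring R] {d l : ℕ} (a : Fin l → Fin d → R) :
    (List.ofFn fun k => ∑ j, a k j).prod =
      ∑ g : Fin l → Fin d, (List.ofFn fun k => a k (g k)).prod := by
  have := (MultilinearMap.mkPiAlgebraFin ℤ l R).map_sum (g := a)
  simpa only [MultilinearMap.mkPiAlgebraFin_apply] using this

theorem List.prod_ofFn_smul {R : Type*} [Ring R] {l : ℕ} (c : Fin l → ℤ) (a : Fin l → R) :
    (List.ofFn fun k => c k • a k).prod = (∏ k, c k) • (List.ofFn a).prod := by
  have := (MultilinearMap.mkPiAlgebraFin ℤ l R).map_smul_univ c a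
  simpa only [MultilinearMap.mkPiAlgebraFin_apply] using this

/-- The alternating sum over all `t` of the indicator of "`g` takes values in `t`" detects
surjectivity of `g`. -/
theorem sum_powerset_indicator_eq_surjective {d l : ℕ} (g : Fin l → Fin d)
    [Decidable (Function.Surjective g)] :
    (∑ t ∈ (Finset.univ : Finset (Fin d)).powerset,
      (∏ _j ∈ Finset.univ \ t, (-1 : ℤ)) * ∏ k, (if g k ∈ t then 1 else 0)) =
      if Function.Surjective g then 1 else 0 := by
  classical
  have key := Finset.prod_add (fun _ : Fin d => (1 : ℤ))
    (fun j => if ∃ k, g k = j then 0 else -1) Finset.univ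
  have h1 : (∏ j : Fin d, ((1 : ℤ) + if ∃ k, g k = j then 0 else -1)) =
      if Function.Surjective g then 1 else 0 := by
    split_ifs with hg
    · exact Finset.prod_eq_one fun j _ => by simp [hg j]
    · simp only [Function.Surjective, not_forall] at hg
      obtain ⟨j, hj⟩ := hg
      exact Finset.prod_eq_zero (Finset.mem_univ j) (by simp [hj])
  rw [← h1, key]
  refine Finset.sum_congr rfl fun t _ => ?_
  rw [Finset.prod_const_one, one_mul]
  by_cases h : ∀ k, g k ∈ t
  · have hone : ∏ k, (if g k ∈ t then (1 : ℤ) else 0) = 1 :=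
      Finset.prod_eq_one fun k _ => by simp [h k]
    rw [hone, mul_one]
    refine Finset.prod_congr rfl fun j hj => ?_
    rw [if_neg]
    rintro ⟨k, rfl⟩
    simp [h k] at hj
  · push Not at h
    obtain ⟨k, hk⟩ := h
    rw [Finset.prod_eq_zero (Finset.mem_univ k) (by simp [hk]), mul_zero,
      Finset.prod_eq_zero (i := g k) (by simp [hk]) (by simp)]

theorem SatisfiesPolynomialIdentity.exists_isMultilinearIdentity {R : Type*} [Ring R]
    (h : SatisfiesPolynomialIdentity R) : ∃ d F, IsMultilinearIdentity R d F := by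
  classical
  obtain ⟨n, f, ⟨w, hw, hmax⟩, hv⟩ := h
  set W : List (Fin n) := FreeMonoid.toList w with hW
  set d := W.length with hd
  let G (u : FreeMonoid (Fin n)) : Finset (Fin (FreeMonoid.toList u).length → Fin d) :=
    Finset.univ.filter fun g =>
      Function.Surjective g ∧ ∀ k, W.get (g k) = (FreeMonoid.toList u).get k
  let F : List ℕ →₀ ℤ := f.sum fun u c => ∑ g ∈ G u,
    Finsupp.single (List.ofFn fun k => (g k : ℕ)) c
  have hlen : ∀ u, f u ≠ 0 → ∀ g ∈ G u, (FreeMonoid.toList u).length = d := by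
    intro u hu g hg
    have h1 := Fintype.card_le_of_surjective g (Finset.mem_filter.1 hg).2.1
    simp only [Fintype.card_fin] at h1
    exact le_antisymm (hmax u hu) h1
  refine ⟨d, F, ?_, ?_, ?_⟩
  · intro l hl
    obtain ⟨u, hu, hl⟩ : ∃ u ∈ f.support, (∑ g ∈ G u,
        Finsupp.single (List.ofFn fun k => (g k : ℕ)) (f u)) l ≠ 0 := by
      by_contra! hcon
      apply hl
      simp only [F, Finsupp.sum, Finsupp.finsetSum_apply] at hcon ⊢
      exact Finset.sum_eq_zero hcon
    rw [Finsupp.finsetSum_apply] at hl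
    obtain ⟨g, hg, hl⟩ := Finset.exists_ne_zero_of_sum_ne_zero hl
    rw [Finsupp.single_apply] at hl
    obtain rfl : (List.ofFn fun k => (g k : ℕ)) = l := by
      by_contra hne
      simp [hne] at hl
    have hlu := hlen u (Finsupp.mem_support_iff.1 hu) g hg
    have hsurj := (Finset.mem_filter.1 hg).2.1
    have hinj : Function.Injective g :=
      ((Fintype.bijective_iff_surjective_and_card g).2 ⟨hsurj, by simpa using hlu⟩).1
    refine (List.perm_ext_iff_of_nodup ?_ List.nodup_range).2 ?_
    · exact List.nodup_ofFn.2 (Fin.val_injective.comp hinj)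
    · intro a
      rw [List.mem_ofFn, List.mem_range]
      constructor
      · rintro ⟨k, rfl⟩
        exact (g k).2
      · intro ha
        obtain ⟨k, hk⟩ := hsurj ⟨a, ha⟩
        exact ⟨k, by simp [hk]⟩
  · have hterm : ∀ u, u ∈ f.support → u ≠ w → (∑ g ∈ G u,
        Finsupp.single (List.ofFn fun k => (g k : ℕ)) (f u)) (List.range d) = 0 := by
      intro u hu huw
      rw [Finsupp.finsetSum_apply]
      refine Finset.sum_eq_zero fun g hg => ?_
      rw [Finsupp.single_apply, if_neg]
      intro hr
      apply huw
      have hlu := hlen u (Finsupp.mem_support_iff.1 hu) g hg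
      apply FreeMonoid.toList.injective
      refine List.ext_get hlu fun k h1 h2 => ?_
      rw [← (Finset.mem_filter.1 hg).2.2 ⟨k, h1⟩]
      congr 1
      have := congrArg (fun l : List ℕ => l[k]?) hr
      rw [List.getElem?_range (by exact h2)] at this
      simp [h1] at this
      exact Fin.ext this
    simp only [F, Finsupp.sum, Finsupp.finsetSum_apply] at hterm ⊢
    rw [Finset.sum_eq_single w hterm (by simp +contextual [hw])]
    rw [Finset.sum_eq_single (fun k => k)]
    · have : (List.ofFn fun k : Fin (FreeMonoid.toList w).length => (k : ℕ)) = List.range d := by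
        apply List.ext_get <;> simp [hd, hW]
      rw [this, Finsupp.single_eq_same, hw]
    · intro g _ hg
      rw [Finsupp.single_apply, if_neg]
      intro hr
      apply hg
      funext k
      have := congrArg (fun l : List ℕ => l[(k : ℕ)]?) hr
      have hk : (k : ℕ) < d := k.2
      simp [List.getElem?_range hk] at this
      exact Fin.ext this
    · intro hne
      exact absurd (Finset.mem_filter.2 ⟨Finset.mem_univ _, fun k => ⟨k, rfl⟩, fun _ => rfl⟩) hne
  · intro y
    have hF : (F.sum fun l c => c • (l.map y).prod) =
        f.sum fun u c => ∑ g ∈ G u, c • (List.ofFn fun k => y (g k)).prod := by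
      rw [Finsupp.sum_sum_index (by simp) (by intros; rw [add_smul])]
      refine Finsupp.sum_congr fun u _ => ?_
      rw [← Finsupp.sum_finsetSum_index (by simp) (by intros; rw [add_smul])]
      refine Finset.sum_congr rfl fun g _ => ?_
      rw [Finsupp.sum_single_index (by simp), List.map_ofFn]
      rfl
    rw [hF]
    have hexp : ∀ u : FreeMonoid (Fin n),
        (∑ g ∈ G u, (List.ofFn fun k => y (g k)).prod) =
        ∑ t ∈ (Finset.univ : Finset (Fin d)).powerset, (∏ _j ∈ Finset.univ \ t, (-1 : ℤ)) •
          ((FreeMonoid.toList u).map fun i =>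
            ∑ j : Fin d, (if j ∈ t then (1 : ℤ) else 0) •
              (if W.get j = i then y j else 0)).prod := by
      intro u
      have h1 : ∀ t : Finset (Fin d), ((FreeMonoid.toList u).map fun i =>
            ∑ j : Fin d, (if j ∈ t then (1 : ℤ) else 0) •
              (if W.get j = i then y j else 0)).prod =
          ∑ g : Fin (FreeMonoid.toList u).length → Fin d,
            (∏ k, (if g k ∈ t then (1 : ℤ) else 0)) •
            (List.ofFn fun k =>
              if W.get (g k) = (FreeMonoid.toList u).get k then y (g k) else 0).prod := by
        intro t
        conv_lhs => rw [← List.ofFn_get (FreeMonoid.toList u), List.map_ofFn]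
        simp only [Function.comp_def]
        rw [List.prod_ofFn_sum]
        exact Finset.sum_congr rfl fun g _ => List.prod_ofFn_smul _ _
      simp only [h1, Finset.smul_sum]
      rw [Finset.sum_comm]
      simp only [smul_smul, ← Finset.sum_smul, sum_powerset_indicator_eq_surjective]
      rw [Finset.sum_filter]
      refine Finset.sum_congr rfl fun g _ => ?_
      by_cases hs : Function.Surjective g
      · by_cases hg : ∀ k, W.get (g k) = (FreeMonoid.toList u).get k
        · simp only [hs, hg, true_and, if_true, one_smul, implies_true]
        · rw [if_neg (fun hh => hg hh.2), if_pos hs, one_smul]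
          push Not at hg
          obtain ⟨k, hk⟩ := hg
          refine (List.prod_eq_zero ?_).symm
          rw [List.mem_ofFn]
          exact ⟨k, if_neg hk⟩
      · simp [hs]
    simp only [← Finset.smul_sum, hexp]
    simp only [Finsupp.sum, Finset.smul_sum]
    rw [Finset.sum_comm]
    refine Finset.sum_eq_zero fun t _ => ?_
    have := hv fun i => ∑ j : Fin d, (if j ∈ t then (1 : ℤ) else 0) •
              (if W.get j = i then y j else 0)
    simp only [smul_comm (f _), ← Finset.smul_sum]
    rw [Finsupp.sum] at this
    rw [this, smul_zero]

theorem List.prod_map_update_add {A : Type*} [Ring A] {l : List ℕ} (hl : l.Nodup) {s : ℕ}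
    (hs : s ∈ l) (y : ℕ → A) (p q : A) :
    (l.map (Function.update y s (p + q))).prod =
      (l.map (Function.update y s p)).prod + (l.map (Function.update y s q)).prod := by
  obtain ⟨l₁, l₂, rfl⟩ := List.append_of_mem hs
  have h₁ : s ∉ l₁ := by
    simp only [List.nodup_append] at hl
    grind
  have h₂ : s ∉ l₂ := fun h => by simp [List.nodup_append, h] at hl
  have key : ∀ a (m : List ℕ), s ∉ m → m.map (Function.update y s a) = m.map y := by
    intro a m hm
    exact List.map_congr_left fun x hx => Function.update_of_ne (by grind) _ _
  simp [key _ _ h₁, key _ _ h₂, mul_add, add_mul]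

theorem Polynomial.prod_map_monomial {R : Type*} [Ring R] (k : ℕ → ℕ) (a : ℕ → R) (l : List ℕ) :
    (l.map fun j => monomial (k j) (a j)).prod = monomial (l.map k).sum (l.map a).prod := by
  induction l with
  | nil => simp
  | cons x l ih => simp [ih, monomial_mul_monomial]

theorem IsMultilinearIdentity.polynomial {R : Type*} [Ring R] {d : ℕ} {F : List ℕ →₀ ℤ}
    (h : IsMultilinearIdentity R d F) : IsMultilinearIdentity R[X] d F := by
  refine ⟨h.perm, h.coeff_range, ?_⟩
  have main : ∀ s ≤ d, ∀ y : ℕ → R[X], (∀ j, s ≤ j → j < d → ∃ k a, y j = monomial k a) →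
      (F.sum fun l c => c • (l.map y).prod) = 0 := by
    intro s
    induction s with
    | zero =>
      intro _ y hy
      have hy' : ∀ j, ∃ k a, j < d → y j = monomial k a := fun j => by
        by_cases hj : j < d
        · obtain ⟨k, a, hka⟩ := hy j j.zero_le hj
          exact ⟨k, a, fun _ => hka⟩
        · exact ⟨0, 0, fun h => absurd h hj⟩
      choose k a hka using hy'
      have : (F.sum fun l c => c • (l.map y).prod) =
          monomial ((List.range d).map k).sum (F.sum fun l c => c • (l.map a).prod) := by
        rw [Finsupp.sum, Finsupp.sum, map_sum]
        refine Finset.sum_congr rfl fun l hl => ?_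
        have hp := h.perm l (Finsupp.mem_support_iff.1 hl)
        rw [List.map_congr_left (g := fun j => monomial (k j) (a j))
          fun j hj => hka j (List.mem_range.1 (hp.mem_iff.1 hj)),
          Polynomial.prod_map_monomial, (hp.map k).sum_eq, map_zsmul]
      rw [this, h.vanish, map_zero]
    | succ s ih =>
      intro hs y hy
      have step : ∀ p : R[X],
          (F.sum fun l c => c • (l.map (Function.update y s p)).prod) = 0 := by
        intro p
        induction p using Polynomial.induction_on' with
        | add p q hp hq =>
          have : (F.sum fun l c => c • (l.map (Function.update y s (p + q))).prod) =
              (F.sum fun l c => c • (l.map (Function.update y s p)).prod) +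
              (F.sum fun l c => c • (l.map (Function.update y s q)).prod) := by
            simp only [Finsupp.sum]
            rw [← Finset.sum_add_distrib]
            refine Finset.sum_congr rfl fun l hl => ?_
            have hp := h.perm l (Finsupp.mem_support_iff.1 hl)
            rw [List.prod_map_update_add (hp.nodup_iff.2 List.nodup_range)
              (hp.mem_iff.2 (List.mem_range.2 hs)), smul_add]
          rw [this, hp, hq, add_zero]
        | monomial k a =>
          refine ih (by omega) _ fun j hj hjd => ?_
          rcases hj.eq_or_lt with rfl | hj
          · exact ⟨k, a, by simp⟩
          · rw [Function.update_of_ne hj.ne']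
            exact hy j hj hjd
      simpa using step (y s)
  exact fun y => main d le_rfl y fun j h1 h2 => by omega

/-- If the operators `r j` act on `v 0, v 1, …` by `v (j + 1) ↦ v j` and kill the other `v i`,
then among the rearrangements of `r 0 * ⋯ * r (d - 1)` only the identity does not
kill `v d`. -/
theorem List.eq_range'_of_prod_smul_ne_zero {A M : Type*} [Ring A] [AddCommGroup M] [Module A M]
    {v : ℕ → M} {r : ℕ → A} {d : ℕ}
    (h1 : ∀ j < d, ∀ i ≤ d, r j • v i = if i = j + 1 then v j else 0)
    (l : List ℕ) (hl : ∀ j ∈ l, j < d) (hne : (l.map r).prod • v d ≠ 0) :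
    ∃ k, k + l.length = d ∧ l = List.range' k l.length ∧ (l.map r).prod • v d = v k := by
  induction l with
  | nil => exact ⟨d, by simp⟩
  | cons x l ih =>
    simp only [List.map_cons, List.prod_cons, mul_smul] at hne ⊢
    obtain ⟨k, hk, hlk, hv⟩ := ih (fun j hj => hl j (by simp [hj])) (by
      intro h0
      simp [h0] at hne)
    have hx := hl x (by simp)
    rw [hv, h1 x hx k (by omega)] at hne ⊢
    split_ifs at hne ⊢ with hkx
    · refine ⟨x, by simp; omega, ?_, rfl⟩
      rw [List.length_cons, List.range'_succ, ← hkx, ← hlk]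
    · exact absurd rfl hne

/-- **Kaplansky**: a simple module over a ring with a multilinear identity is finite-dimensional
over its endomorphism ring. -/
theorem IsMultilinearIdentity.finite_end {A M : Type*} [Ring A] [AddCommGroup M] [Module A M]
    [IsSimpleModule A M] {d : ℕ} {F : List ℕ →₀ ℤ} (h : IsMultilinearIdentity A d F) :
    Module.Finite (Module.End A M) M := by
  classical
  let E := Module.End A M
  let b := Module.Free.chooseBasis E M
  by_contra hfin
  have hinf : Infinite (Module.Free.ChooseBasisIndex E M) := by
    by_contra hI
    have := not_infinite_iff_finite.1 hI
    exact hfin (Module.Finite.of_basis b)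
  let e := Infinite.natEmbedding (Module.Free.ChooseBasisIndex E M)
  let v : ℕ → M := fun j => b (e j)
  have hr : ∀ j, ∃ r : A, ∀ i ≤ d, r • v i = if i = j + 1 then v j else 0 := by
    intro j
    obtain ⟨r, hr⟩ := jacobson_density (R := A)
      (b.constr ℕ fun i => if i = e (j + 1) then v j else 0) ((Finset.range (d + 1)).image v)
    refine ⟨r, fun i hi => ?_⟩
    rw [← hr _ (Finset.mem_image_of_mem _ (Finset.mem_range.2 (by omega)))]
    simp [v, Module.Basis.constr_basis]
  choose r hr using hr
  have hv := congrArg (· • v d) (h.vanish r)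
  simp only [Finsupp.sum, Finset.sum_smul, zero_smul] at hv
  have hrange : ((List.range d).map r).prod • v d = v 0 := by
    have : ∀ k ≤ d, ((List.range k).map r).prod • v k = v 0 := by
      intro k
      induction k with
      | zero => simp
      | succ k ih =>
        intro hk
        rw [List.range_succ, List.map_append, List.prod_append, mul_smul]
        simp [hr k (k + 1) hk, ih (by omega)]
    exact this d le_rfl
  rw [Finset.sum_eq_single (List.range d)] at hv
  · rw [h.coeff_range, one_smul, hrange] at hv
    exact b.ne_zero _ hv
  · intro l hl hne
    by_contra hc
    have hp := h.perm l (Finsupp.mem_support_iff.1 hl)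
    obtain ⟨k, hk, hlk, -⟩ := List.eq_range'_of_prod_smul_ne_zero (fun j _ => hr j) l
      (fun j hj => List.mem_range.1 (hp.mem_iff.1 hj)) (by
        intro h0
        rw [smul_assoc, h0, smul_zero] at hc
        exact hc rfl)
    have hlen := hp.length_eq
    rw [List.length_range] at hlen
    obtain rfl : k = 0 := by omega
    exact hne (by rw [hlk, hlen, List.range_eq_range'])
  · intro hc
    rw [Finsupp.notMem_support_iff.1 hc]
    simp

theorem Polynomial.one_sub_C_mul_X_span_ne_top {R : Type*} [Ring R] {c : R}
    (hc : ¬ IsNilpotent c) : Ideal.span {1 - C c * X} ≠ (⊤ : Ideal R[X]) := by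
  intro htop
  have h1 := (Ideal.eq_top_iff_one _).1 htop
  obtain ⟨g, hg⟩ := Submodule.mem_span_singleton.1 h1
  have hg' : g = 1 + g * C c * X := by
    rw [smul_eq_mul, mul_sub, mul_one] at hg
    rw [← hg, mul_assoc]
    abel
  have hcoeff : ∀ n, g.coeff n = c ^ n := by
    intro n
    induction n with
    | zero => rw [hg']; simp
    | succ n ih => rw [hg', coeff_add, coeff_mul_X, coeff_mul_C, ih, coeff_one]; simp [pow_succ]
  exact hc ⟨g.natDegree + 1, by
    rw [← hcoeff, coeff_eq_zero_of_natDegree_lt (Nat.lt_succ_self _)]⟩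

/-- If `c` is a non-nilpotent element of a PI ring `R`, then `R[X]` has a nontrivial Noetherian
quotient in which the ideal generated by `c` becomes the unit ideal. -/
theorem exists_noetherian_quotient_of_not_isNilpotent.{u} {R : Type u} [Ring R] {d : ℕ}
    {F : List ℕ →₀ ℤ} (h : IsMultilinearIdentity R d F) {c : R} (hc : ¬ IsNilpotent c) :
    ∃ (L : Type u) (_ : Ring L) (φ : R[X] →+* L) (a : R[X]),
      Nontrivial L ∧ IsNoetherianRing L ∧ Function.Surjective φ ∧ φ a = 1 ∧
      ∀ K : TwoSidedIdeal R[X], C c ∈ K → a ∈ K := by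
  classical
  obtain ⟨m, hm, hle⟩ := Ideal.exists_le_maximal _ (Polynomial.one_sub_C_mul_X_span_ne_top hc)
  let A := R[X]
  let M := A ⧸ m
  have : IsSimpleModule A M := isSimpleModule_iff_isCoatom.2 hm.out
  have hfin : Module.Finite (Module.End A M) M := h.polynomial.finite_end
  let b := Module.Free.chooseBasis (Module.End A M) M
  obtain ⟨x, hx⟩ : ∃ x : M, (C c : A) • x ≠ 0 := by
    by_contra! hcon
    have h1 : (1 - C c * X : A) • (Submodule.Quotient.mk 1 : M) = 0 := by
      rw [← Submodule.Quotient.mk_smul, Submodule.Quotient.mk_eq_zero]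
      simpa using hle (Ideal.subset_span rfl)
    rw [sub_smul, one_smul, mul_smul, hcon, sub_zero, Submodule.Quotient.mk_eq_zero] at h1
    exact hm.ne_top ((Ideal.eq_top_iff_one _).2 h1)
  have hp : ∀ i, ∃ p : A, ∀ j, p • b j = if j = i then x else 0 := by
    intro i
    obtain ⟨r, hr⟩ := jacobson_density (R := A)
      (b.constr ℕ fun j => if j = i then x else 0) (Finset.univ.image b)
    exact ⟨r, fun j => by
      rw [← hr _ (Finset.mem_image_of_mem _ (Finset.mem_univ _)), Module.Basis.constr_basis]⟩
  choose p hp using hp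
  have hq : ∀ i, ∃ q : A, q • ((C c : A) • x) = b i := fun i =>
    IsSimpleModule.toSpanSingleton_surjective A hx (b i)
  choose q hq using hq
  let a : A := ∑ i, q i * C c * p i
  have hab : ∀ j, a • b j = b j := by
    intro j
    simp only [a, Finset.sum_smul, mul_smul, hp]
    rw [Finset.sum_eq_single j (fun i _ hij => by simp [hij.symm]) (by simp)]
    rw [if_pos rfl, hq]
  have ha : ∀ y : M, a • y = y := by
    intro y
    rw [← b.sum_repr y, Finset.smul_sum]
    refine Finset.sum_congr rfl fun j _ => ?_
    rw [smul_comm, hab]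
  let I : Ideal A := Module.annihilator A M
  have hnoeth : IsNoetherian A (A ⧸ I) := by
    let f : (A ⧸ I) →ₗ[A] ((_ : Module.Free.ChooseBasisIndex (Module.End A M) M) → M) :=
      Submodule.liftQ I (LinearMap.pi fun i => LinearMap.toSpanSingleton A M (b i)) (by
        intro r hr
        ext i
        simpa using Module.mem_annihilator.1 hr (b i))
    refine isNoetherian_of_injective f ?_
    rw [← LinearMap.ker_eq_bot, LinearMap.ker_eq_bot']
    intro y
    obtain ⟨r, rfl⟩ := Submodule.Quotient.mk_surjective I y
    intro hr
    rw [Submodule.Quotient.mk_eq_zero]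
    refine Module.mem_annihilator.2 fun y => ?_
    rw [← b.sum_repr y, Finset.smul_sum]
    refine Finset.sum_eq_zero fun j _ => ?_
    have : r • b j = 0 := congrFun hr j
    rw [smul_comm, this, smul_zero]
  refine ⟨A ⧸ I, inferInstance, Ideal.Quotient.mk I, a, ?_, isNoetherian_of_tower A hnoeth,
    Ideal.Quotient.mk_surjective, ?_, ?_⟩
  · rw [Ideal.Quotient.nontrivial_iff]
    intro htop
    exact hx (Module.mem_annihilator.1 (htop ▸ Submodule.mem_top : (C c : A) ∈ I) x)
  · rw [← map_one (Ideal.Quotient.mk I), Ideal.Quotient.mk_eq_mk_iff_sub_mem]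
    exact Module.mem_annihilator.2 fun y => by rw [sub_smul, ha, one_smul, sub_self]
  · intro K hK
    exact sum_mem fun i _ => K.mul_mem_right _ _ (K.mul_mem_left _ _ hK)

namespace IsOreExtension

section Basic

variable {R S : Type*} [Ring R] [Ring S] {σ D : R → R} {ι : R → S} {X : S}

theorem σ_zero (h : IsOreExtension σ D ι X) : σ 0 = 0 := by
  simpa using h.σ_add 0 0

theorem D_zero (h : IsOreExtension σ D ι X) : D 0 = 0 := by
  simpa using h.D_add 0 0

theorem ι_zero (h : IsOreExtension σ D ι X) : ι 0 = 0 := by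
  simpa using h.ι_add 0 0

/-- The inclusion of coefficients as a ring homomorphism. -/
def coeffHom (h : IsOreExtension σ D ι X) : R →+* S where
  toFun := ι
  map_one' := h.ι_one
  map_mul' := h.ι_mul
  map_zero' := h.ι_zero
  map_add' := h.ι_add

/-- The automorphism `σ` as a ring homomorphism. -/
def twistHom (h : IsOreExtension σ D ι X) : R →+* R where
  toFun := σ
  map_one' := h.σ_one
  map_mul' := h.σ_mul
  map_zero' := h.σ_zero
  map_add' := h.σ_add

/-- The additive map sending a finitely supported family of coefficients to the corresponding
element of the Ore extension. -/
noncomputable def ofCoeffs (h : IsOreExtension σ D ι X) : (ℕ →₀ R) →+ S :=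
  Finsupp.liftAddHom fun i => (AddMonoidHom.mulRight (X ^ i)).comp (h.coeffHom : R →+ S)

theorem ofCoeffs_apply (h : IsOreExtension σ D ι X) (c : ℕ →₀ R) :
    h.ofCoeffs c = c.sum fun i a => ι a * X ^ i := rfl

theorem ofCoeffs_single (h : IsOreExtension σ D ι X) (i : ℕ) (a : R) :
    h.ofCoeffs (Finsupp.single i a) = ι a * X ^ i := by
  rw [h.ofCoeffs_apply, Finsupp.sum_single_index (by rw [h.ι_zero, zero_mul])]

theorem ofCoeffs_bijective (h : IsOreExtension σ D ι X) : Function.Bijective h.ofCoeffs :=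
  ⟨(injective_iff_map_eq_zero _).2 fun c hc => h.uniq c hc,
    fun s => (h.repr s).imp fun _ hc => hc.symm⟩

/-- The coefficients of an element of the Ore extension. -/
noncomputable def coeffs (h : IsOreExtension σ D ι X) : S ≃+ (ℕ →₀ R) :=
  (AddEquiv.ofBijective h.ofCoeffs h.ofCoeffs_bijective).symm

theorem coeffs_ofCoeffs (h : IsOreExtension σ D ι X) (c : ℕ →₀ R) :
    h.coeffs (h.ofCoeffs c) = c :=
  (AddEquiv.ofBijective h.ofCoeffs h.ofCoeffs_bijective).symm_apply_apply c

theorem ofCoeffs_coeffs (h : IsOreExtension σ D ι X) (s : S) :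
    h.ofCoeffs (h.coeffs s) = s :=
  (AddEquiv.ofBijective h.ofCoeffs h.ofCoeffs_bijective).apply_symm_apply s

theorem coeffs_monomial (h : IsOreExtension σ D ι X) (i : ℕ) (a : R) :
    h.coeffs (ι a * X ^ i) = Finsupp.single i a := by
  rw [← h.ofCoeffs_single, h.coeffs_ofCoeffs]

theorem coeffs_one (h : IsOreExtension σ D ι X) : h.coeffs 1 = Finsupp.single 0 1 := by
  simpa [h.ι_one] using h.coeffs_monomial 0 1

theorem coeffs_ι_mul (h : IsOreExtension σ D ι X) (a : R) (s : S) (n : ℕ) :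
    h.coeffs (ι a * s) n = a * h.coeffs s n := by
  classical
  rw [← h.ofCoeffs_coeffs s]
  induction h.coeffs s using Finsupp.induction_linear with
  | zero => simp
  | add p q hp hq => simp only [map_add, mul_add, Finsupp.add_apply, hp, hq]
  | single i b =>
    rw [h.ofCoeffs_single, ← mul_assoc, ← h.ι_mul, h.coeffs_monomial, h.coeffs_monomial,
      Finsupp.single_apply, Finsupp.single_apply]
    split_ifs <;> simp

/-- The elements of the Ore extension of degree less than `d`. -/
noncomputable def lower (h : IsOreExtension σ D ι X) (d : ℕ) : AddSubgroup S where
  carrier := {s | ∀ n, d ≤ n → h.coeffs s n = 0}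
  zero_mem' := by simp
  add_mem' := by
    intro a b ha hb n hn
    rw [map_add, Finsupp.add_apply, ha n hn, hb n hn, add_zero]
  neg_mem' := by
    intro a ha n hn
    rw [map_neg, Finsupp.neg_apply, ha n hn, neg_zero]

theorem lower_mono (h : IsOreExtension σ D ι X) {d e : ℕ} (hde : d ≤ e) :
    h.lower d ≤ h.lower e :=
  fun _ hs n hn => hs n (hde.trans hn)

theorem monomial_mem_lower (h : IsOreExtension σ D ι X) {d i : ℕ} (hi : i < d) (a : R) :
    ι a * X ^ i ∈ h.lower d := by
  intro n hn
  rw [h.coeffs_monomial, Finsupp.single_apply, if_neg (by omega)]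

theorem lower_le_of_monomial (h : IsOreExtension σ D ι X) {d : ℕ} {P : AddSubgroup S}
    (hP : ∀ i < d, ∀ a, ι a * X ^ i ∈ P) : h.lower d ≤ P := by
  intro s hs
  rw [← h.ofCoeffs_coeffs s, h.ofCoeffs_apply]
  refine sum_mem fun i hi => hP i ?_ _
  by_contra hc
  exact (Finsupp.mem_support_iff.1 hi) (hs i (by omega))

theorem ι_mul_mem_lower (h : IsOreExtension σ D ι X) {d : ℕ} (a : R) {s : S}
    (hs : s ∈ h.lower d) : ι a * s ∈ h.lower d := by
  intro n hn
  rw [h.coeffs_ι_mul, hs n hn, mul_zero]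

theorem X_mul_mem_lower (h : IsOreExtension σ D ι X) {d : ℕ} {s : S}
    (hs : s ∈ h.lower d) : X * s ∈ h.lower (d + 1) := by
  refine h.lower_le_of_monomial (P := (h.lower (d + 1)).comap (AddMonoidHom.mulLeft X)) ?_ hs
  intro i hi a
  rw [AddSubgroup.mem_comap, AddMonoidHom.coe_mulLeft, ← mul_assoc, h.X_comm, add_mul, mul_assoc,
    ← pow_succ']
  exact add_mem (h.monomial_mem_lower (by omega) _) (h.monomial_mem_lower (by omega) _)

/-- `F` has degree at most `d`, with coefficient `b` in degree `d`. -/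
def HasLead (h : IsOreExtension σ D ι X) (d : ℕ) (b : R) (F : S) : Prop :=
  F - ι b * X ^ d ∈ h.lower d

theorem HasLead.coeff_eq (h : IsOreExtension σ D ι X) {d : ℕ} {b : R} {F : S}
    (hF : h.HasLead d b F) : h.coeffs F d = b := by
  have := hF d le_rfl
  rw [map_sub, Finsupp.sub_apply, h.coeffs_monomial, Finsupp.single_eq_same] at this
  exact sub_eq_zero.1 this

theorem HasLead.mem_lower (h : IsOreExtension σ D ι X) {d : ℕ} {b : R} {F : S}
    (hF : h.HasLead d b F) : F ∈ h.lower (d + 1) := by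
  have := add_mem (h.lower_mono (Nat.le_succ d) hF) (h.monomial_mem_lower (Nat.lt_succ_self d) b)
  simpa using this

theorem HasLead.add (h : IsOreExtension σ D ι X) {d : ℕ} {b b' : R} {F F' : S}
    (hF : h.HasLead d b F) (hF' : h.HasLead d b' F') : h.HasLead d (b + b') (F + F') := by
  have := add_mem hF hF'
  rw [HasLead, h.ι_add]
  convert this using 1
  noncomm_ring

theorem HasLead.ι_mul (h : IsOreExtension σ D ι X) {d : ℕ} {b : R} {F : S}
    (hF : h.HasLead d b F) (a : R) : h.HasLead d (a * b) (ι a * F) := by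
  have := h.ι_mul_mem_lower a hF
  rwa [mul_sub, ← mul_assoc, ← h.ι_mul] at this

theorem HasLead.X_mul (h : IsOreExtension σ D ι X) {d : ℕ} {b : R} {F : S}
    (hF : h.HasLead d b F) : h.HasLead (d + 1) (σ b) (X * F) := by
  have h1 := h.X_mul_mem_lower hF
  have h2 := h.monomial_mem_lower (Nat.lt_succ_self d) (D b)
  have := add_mem h1 h2
  rw [HasLead]
  convert this using 1
  rw [mul_sub, ← mul_assoc X (ι b), h.X_comm, add_mul, mul_assoc (ι (σ b)), ← pow_succ']
  abel

theorem HasLead.X_pow_mul (h : IsOreExtension σ D ι X) {d : ℕ} {b : R} {F : S}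
    (hF : h.HasLead d b F) (n : ℕ) : h.HasLead (n + d) (σ^[n] b) (X ^ n * F) := by
  induction n with
  | zero => simpa using hF
  | succ n ih =>
    rw [Function.iterate_succ_apply', pow_succ', mul_assoc, Nat.add_right_comm]
    exact ih.X_mul

theorem hasLead_ι (h : IsOreExtension σ D ι X) (a : R) : h.HasLead 0 a (ι a) := by
  simp [HasLead, zero_mem]

theorem mul_ι_mem_lower (h : IsOreExtension σ D ι X) {d : ℕ} {s : S}
    (hs : s ∈ h.lower d) (a : R) : s * ι a ∈ h.lower d := by
  refine h.lower_le_of_monomial (P := (h.lower d).comap (AddMonoidHom.mulRight (ι a))) ?_ hs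
  intro i hi b
  change ι b * X ^ i * ι a ∈ h.lower d
  rw [mul_assoc]
  refine h.ι_mul_mem_lower b (h.lower_mono hi ?_)
  simpa using ((h.hasLead_ι a).X_pow_mul h i).mem_lower

theorem HasLead.mul_ι (h : IsOreExtension σ D ι X) {d : ℕ} {b : R} {F : S}
    (hF : h.HasLead d b F) (a : R) : h.HasLead d (b * σ^[d] a) (F * ι a) := by
  have h1 := h.mul_ι_mem_lower hF a
  have h2 := ((h.hasLead_ι a).X_pow_mul h d).ι_mul h b
  have := add_mem h1 h2
  rw [HasLead]
  convert this using 1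
  rw [add_zero]
  noncomm_ring

/-- The leading coefficients, in all sufficiently large degrees, of the elements of the two-sided
ideal `J`. -/
noncomputable def leadIdeal (h : IsOreExtension σ D ι X) (hσ : Function.Surjective σ)
    (J : TwoSidedIdeal S) : TwoSidedIdeal R :=
  TwoSidedIdeal.mk' {b | ∃ d₀, ∀ d, d₀ ≤ d → ∃ F ∈ J, h.HasLead d b F}
    ⟨0, fun d _ => ⟨0, J.zero_mem, by simp [HasLead, h.ι_zero, zero_mem]⟩⟩
    (by
      rintro x y ⟨d₁, h₁⟩ ⟨d₂, h₂⟩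
      refine ⟨max d₁ d₂, fun d hd => ?_⟩
      obtain ⟨F₁, hF₁, hl₁⟩ := h₁ d (le_of_max_le_left hd)
      obtain ⟨F₂, hF₂, hl₂⟩ := h₂ d (le_of_max_le_right hd)
      exact ⟨_, J.add_mem hF₁ hF₂, hl₁.add h hl₂⟩)
    (by
      rintro x ⟨d₁, h₁⟩
      refine ⟨d₁, fun d hd => ?_⟩
      obtain ⟨F, hF, hl⟩ := h₁ d hd
      refine ⟨_, J.mul_mem_left (ι (-1)) _ hF, ?_⟩
      simpa using hl.ι_mul h (-1))
    (by
      rintro x y ⟨d₁, h₁⟩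
      refine ⟨d₁, fun d hd => ?_⟩
      obtain ⟨F, hF, hl⟩ := h₁ d hd
      exact ⟨_, J.mul_mem_left (ι x) _ hF, hl.ι_mul h x⟩)
    (by
      rintro x y ⟨d₁, h₁⟩
      refine ⟨d₁, fun d hd => ?_⟩
      obtain ⟨F, hF, hl⟩ := h₁ d hd
      obtain ⟨z, rfl⟩ := hσ.iterate d y
      exact ⟨_, J.mul_mem_right _ (ι z) hF, hl.mul_ι h z⟩)

theorem mem_leadIdeal (h : IsOreExtension σ D ι X) (hσ : Function.Surjective σ)
    (J : TwoSidedIdeal S) {b : R} :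
    b ∈ h.leadIdeal hσ J ↔ ∃ d₀, ∀ d, d₀ ≤ d → ∃ F ∈ J, h.HasLead d b F :=
  TwoSidedIdeal.mem_mk' ..

theorem σ_mem_leadIdeal (h : IsOreExtension σ D ι X) (hσ : Function.Surjective σ)
    (J : TwoSidedIdeal S) {b : R} (hb : b ∈ h.leadIdeal hσ J) : σ b ∈ h.leadIdeal hσ J := by
  rw [mem_leadIdeal] at hb ⊢
  obtain ⟨d₀, hd₀⟩ := hb
  refine ⟨d₀ + 1, fun d hd => ?_⟩
  obtain ⟨F, hF, hl⟩ := hd₀ (d - 1) (by omega)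
  refine ⟨_, J.mul_mem_left X _ hF, ?_⟩
  have := hl.X_mul h
  rwa [Nat.sub_add_cancel (by omega)] at this

theorem mem_leadIdeal_of_ι_mem (h : IsOreExtension σ D ι X) (hσ : Function.Surjective σ)
    (J : TwoSidedIdeal S) {b : R} (hb : ι b ∈ J) : b ∈ h.leadIdeal hσ J := by
  rw [mem_leadIdeal]
  exact ⟨0, fun d _ => ⟨_, J.mul_mem_right _ (X ^ d) hb, by simp [HasLead, zero_mem]⟩⟩

/-- If `P` is a proper right ideal of coefficients modulo which all `σⁿ(b)` are right regular,
then an element `1 - F`, where `F` has positive degree and leading coefficient `b`, is not left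
invertible modulo `P`. -/
theorem not_left_inverse_of_hasLead (h : IsOreExtension σ D ι X) {P : AddSubgroup R}
    (hPmul : ∀ a ∈ P, ∀ r, a * r ∈ P) (hP1 : (1 : R) ∉ P) {d : ℕ} (hd : 0 < d) {b : R} {F : S}
    (hF : h.HasLead d b F) (hreg : ∀ n a, a * σ^[n] b ∈ P → a ∈ P)
    {u v : S} (hv : ∀ n, h.coeffs v n ∈ P) (huv : u * (1 - F) = 1 + v) : False := by
  classical
  have hcoeff : ∀ k, h.coeffs (u * F) k =
      (h.coeffs u).sum fun i a => a * h.coeffs (X ^ i * F) k := by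
    intro k
    conv_lhs => rw [← h.ofCoeffs_coeffs u, h.ofCoeffs_apply, Finsupp.sum, Finset.sum_mul, map_sum,
      Finsupp.finsetSum_apply]
    exact Finset.sum_congr rfl fun i _ => by rw [mul_assoc, h.coeffs_ι_mul]
  have hrel : ∀ k, h.coeffs u k - h.coeffs (u * F) k =
      (if k = 0 then 1 else 0) + h.coeffs v k := by
    intro k
    rw [← Finsupp.sub_apply, ← map_sub, ← mul_one_sub, huv, map_add, Finsupp.add_apply,
      h.coeffs_one, Finsupp.single_apply]
    simp only [eq_comm]
  by_cases hall : ∀ n, h.coeffs u n ∈ P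
  · apply hP1
    have h0 := hrel 0
    rw [if_pos rfl] at h0
    rw [← add_sub_cancel_right 1 (h.coeffs v 0), ← h0]
    refine sub_mem (sub_mem (hall 0) ?_) (hv 0)
    rw [hcoeff]
    exact sum_mem fun i _ => hPmul _ (hall i) _
  · push Not at hall
    let T := (h.coeffs u).support.filter fun n => h.coeffs u n ∉ P
    have hT : T.Nonempty := by
      obtain ⟨n, hn⟩ := hall
      refine ⟨n, Finset.mem_filter.2 ⟨Finsupp.mem_support_iff.2 ?_, hn⟩⟩
      intro h0
      exact hn (h0 ▸ P.zero_mem)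
    let n := T.max' hT
    have hn : h.coeffs u n ∉ P := (Finset.mem_filter.1 (T.max'_mem hT)).2
    have hmax : ∀ i, n < i → h.coeffs u i ∈ P := by
      intro i hi
      by_contra hc
      refine absurd (T.le_max' i (Finset.mem_filter.2 ⟨Finsupp.mem_support_iff.2 ?_, hc⟩)) hi.not_ge
      intro h0
      exact hc (h0 ▸ P.zero_mem)
    have h1 := hrel (n + d)
    rw [if_neg (by omega), zero_add] at h1
    have h2 : h.coeffs (u * F) (n + d) ∈ P := by
      have := sub_mem (hmax (n + d) (by omega)) (hv (n + d))
      rwa [← h1, sub_sub_cancel] at this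
    rw [hcoeff, Finsupp.sum, ← Finset.add_sum_erase _ _ (Finset.mem_filter.1 (T.max'_mem hT)).1]
      at h2
    have h3 : ∑ i ∈ (h.coeffs u).support.erase n,
        h.coeffs u i * h.coeffs (X ^ i * F) (n + d) ∈ P := by
      refine sum_mem fun i hi => ?_
      rcases lt_or_gt_of_ne (Finset.ne_of_mem_erase hi) with hlt | hgt
      · rw [(hF.X_pow_mul h i).mem_lower h (n + d) (by omega), mul_zero]
        exact P.zero_mem
      · exact hPmul _ (hmax i hgt) _
    have h4 := (P.add_mem_cancel_right h3).1 h2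
    rw [(hF.X_pow_mul h n).coeff_eq] at h4
    exact hn (hreg n _ h4)

end Basic

/-- Adjoining a central variable to an Ore extension. -/
theorem polynomial {R S : Type*} [Ring R] [Ring S] {σ D : R → R} {ι : R → S} {X : S}
    (h : IsOreExtension σ D ι X) :
    IsOreExtension (Polynomial.map h.twistHom)
      (fun p => p.sum fun n a => Polynomial.monomial n (D a))
      (Polynomial.map h.coeffHom) (C X) := by
  have hDadd : ∀ p q : R[X], ((p + q).sum fun n a => Polynomial.monomial n (D a)) =
      (p.sum fun n a => Polynomial.monomial n (D a)) +
      q.sum fun n a => Polynomial.monomial n (D a) := by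
    intro p q
    exact Polynomial.sum_add_index p q _ (by simp [h.D_zero]) (by simp [h.D_add])
  have hDmon : ∀ n a, ((Polynomial.monomial n a : R[X]).sum fun n a =>
      Polynomial.monomial n (D a)) = Polynomial.monomial n (D a) := by
    intro n a
    exact Polynomial.sum_monomial_index _ _ (by simp [h.D_zero])
  refine ⟨fun a b => Polynomial.map_add _, fun a b => Polynomial.map_mul _, Polynomial.map_one _,
    hDadd, ?_, fun a b => Polynomial.map_add _, fun a b => Polynomial.map_mul _,
    Polynomial.map_one _, ?_, ?_, ?_⟩
  · intro a b
    induction a using Polynomial.induction_on' with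
    | add p q hp hq =>
      rw [add_mul, hDadd, hp, hq, Polynomial.map_add, hDadd]
      noncomm_ring
    | monomial n a =>
      induction b using Polynomial.induction_on' with
      | add p q hp hq =>
        rw [mul_add, hDadd, hp, hq, hDadd]
        noncomm_ring
      | monomial m b =>
        rw [Polynomial.monomial_mul_monomial, hDmon, hDmon, hDmon, h.D_mul, Polynomial.map_monomial,
          Polynomial.monomial_mul_monomial, Polynomial.monomial_mul_monomial, map_add]
        rfl
  · intro a
    induction a using Polynomial.induction_on' with
    | add p q hp hq =>
      rw [Polynomial.map_add, mul_add, hp, hq, hDadd, Polynomial.map_add, Polynomial.map_add,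
        Polynomial.map_add, add_mul]
      abel
    | monomial n a =>
      rw [hDmon, Polynomial.map_monomial, Polynomial.map_monomial, Polynomial.map_monomial,
        Polynomial.map_monomial, Polynomial.C_mul_monomial, Polynomial.monomial_mul_C, ← map_add]
      exact congrArg _ (h.X_comm a)
  · intro s
    induction s using Polynomial.induction_on' with
    | add p q hp hq =>
      obtain ⟨c, hc⟩ := hp
      obtain ⟨c', hc'⟩ := hq
      exact ⟨c + c', by
        rw [hc, hc', Finsupp.sum_add_index' (by simp) (by simp [add_mul])]⟩
    | monomial n s =>
      obtain ⟨c, rfl⟩ := h.repr s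
      refine ⟨c.mapRange (Polynomial.monomial n) (map_zero _), ?_⟩
      rw [Finsupp.sum_mapRange_index (by simp), Finsupp.sum, Finsupp.sum, map_sum]
      refine Finset.sum_congr rfl fun i _ => ?_
      rw [Polynomial.map_monomial, ← C_pow, Polynomial.monomial_mul_C]
      rfl
  · intro c hc
    ext i n
    have hn : Finsupp.mapRange (Polynomial.lcoeff R n) (map_zero _) c = 0 := by
      apply h.uniq
      rw [Finsupp.sum_mapRange_index (by simp [h.ι_zero])]
      have := congrArg (fun p : S[X] => p.coeff n) hc
      simp only [Finsupp.sum, Polynomial.finsetSum_coeff, ← C_pow, Polynomial.coeff_mul_C,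
        Polynomial.coeff_map, Polynomial.coeff_zero] at this
      exact this
    exact DFunLike.congr_fun hn i

end IsOreExtension

theorem Polynomial.commute_map_intCast {S : Type*} [Ring S] (χ : ℤ[X]) (p : S[X]) :
    Commute (χ.map (Int.castRingHom S)) p := by
  induction χ using Polynomial.induction_on' with
  | add χ₁ χ₂ h₁ h₂ => simpa using h₁.add_left h₂
  | monomial n k =>
    rw [Polynomial.map_monomial, ← C_mul_X_pow_eq_monomial, eq_intCast, map_intCast]
    exact (Int.cast_commute k p).mul_left ((Polynomial.commute_X p).pow_left n)

/-- If the coefficients of `F` lie in the Jacobson radical of `S`, then `1 - F` is left invertible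
modulo every central monic polynomial. -/
theorem Polynomial.exists_mul_one_sub_eq {S : Type*} [Ring S] {F : S[X]}
    (hF : ∀ n, F.coeff n ∈ Ring.jacobson S) {χ : ℤ[X]} (hχ : χ.Monic) :
    ∃ u v : S[X], u * (1 - F) = 1 + χ.map (Int.castRingHom S) * v := by
  classical
  nontriviality S
  let q : S[X] := χ.map (Int.castRingHom S)
  have hq : q.Monic := hχ.map _
  let N : Ideal S[X] := Ideal.span {1 - F, q}
  let N' : Submodule S S[X] := N.ofPolynomial
  have hqN : ∀ p, q * p ∈ N := fun p => by
    rw [(Polynomial.commute_map_intCast χ p).eq]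
    exact N.mul_mem_left _ (Ideal.subset_span (Set.mem_insert_of_mem _ rfl))
  have hmk : ∀ p, N'.mkQ p = N'.mkQ (p %ₘ q) := fun p => by
    rw [← sub_eq_zero, ← map_sub, Submodule.mkQ_apply, Submodule.Quotient.mk_eq_zero]
    change p - p %ₘ q ∈ N
    have := Polynomial.modByMonic_add_div p q
    rw [sub_eq_of_eq_add' this.symm]
    exact hqN _
  have hfg : (⊤ : Submodule S (S[X] ⧸ N')).FG := by
    have h1 : (Polynomial.degreeLT S q.natDegree).FG :=
      ⟨_, (Polynomial.degreeLT_eq_span_X_pow (R := S)).symm⟩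
    convert h1.map N'.mkQ using 1
    refine (eq_top_iff.2 fun w _ => ?_).symm
    obtain ⟨p, rfl⟩ := N'.mkQ_surjective w
    refine ⟨p %ₘ q, ?_, (hmk p).symm⟩
    rw [SetLike.mem_coe, Polynomial.mem_degreeLT, ← Polynomial.degree_eq_natDegree hq.ne_zero]
    exact Polynomial.degree_modByMonic_lt p hq
  have hle : (⊤ : Submodule S (S[X] ⧸ N')) ≤ Ring.jacobson S • ⊤ := by
    intro w _
    obtain ⟨p, rfl⟩ := N'.mkQ_surjective w
    have h1 : N'.mkQ p = N'.mkQ (p * F) := by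
      rw [← sub_eq_zero, ← map_sub, Submodule.mkQ_apply, Submodule.Quotient.mk_eq_zero]
      change p - p * F ∈ N
      rw [← mul_one_sub]
      exact N.mul_mem_left _ (Ideal.subset_span (by simp))
    rw [h1, ← sum_C_mul_X_pow_eq (p * F), Polynomial.sum, map_sum]
    refine sum_mem fun n _ => ?_
    rw [C_mul', map_smul]
    refine Submodule.smul_mem_smul ?_ trivial
    rw [coeff_mul]
    exact sum_mem fun i _ => Ideal.mul_mem_left _ _ (hF _)
  have hbot := hfg.eq_bot_of_le_jacobson_smul hle
  have h1 : (1 : S[X]) ∈ N := by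
    have : N'.mkQ 1 ∈ (⊤ : Submodule S (S[X] ⧸ N')) := trivial
    rw [hbot, Submodule.mem_bot, Submodule.mkQ_apply, Submodule.Quotient.mk_eq_zero] at this
    exact this
  obtain ⟨u, v, huv⟩ := Ideal.mem_span_pair.1 h1
  refine ⟨u, -v, ?_⟩
  rw [(Polynomial.commute_map_intCast χ (-v)).eq, neg_mul, eq_add_neg_iff_add_eq]
  exact huv

theorem Ideal.leadingCoeffNth_mono_left {L : Type*} [Ring L] {I J : Ideal L[X]} (hIJ : I ≤ J)
    (n : ℕ) : I.leadingCoeffNth n ≤ J.leadingCoeffNth n :=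
  Submodule.map_mono (inf_le_inf le_rfl hIJ)

theorem Ideal.leadingCoeffNth_mono_right {L : Type*} [Ring L] (I : Ideal L[X]) :
    Monotone I.leadingCoeffNth := by
  refine monotone_nat_of_le_succ fun n => ?_
  rintro _ ⟨p, ⟨hp, hpI⟩, rfl⟩
  refine ⟨X * p, ⟨?_, I.mul_mem_left _ hpI⟩, by simp⟩
  rw [SetLike.mem_coe, Polynomial.mem_degreeLE] at hp ⊢
  refine (Polynomial.degree_mul_le _ _).trans ?_
  rw [add_comm, Nat.cast_add]
  exact add_le_add hp degree_X_le

theorem Ideal.le_of_leadingCoeffNth_le {L : Type*} [Ring L] {I J : Ideal L[X]} (hIJ : I ≤ J)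
    (h : ∀ n, J.leadingCoeffNth n ≤ I.leadingCoeffNth n) : J ≤ I := by
  suffices ∀ n : ℕ, ∀ p ∈ J, p.degree < n → p ∈ I from fun p hp =>
    this (p.natDegree + 1) p hp (Polynomial.degree_le_natDegree.trans_lt (by exact_mod_cast Nat.lt_succ_self _))
  intro n
  induction n with
  | zero =>
    intro p _ hp
    simp only [Nat.cast_zero, ← not_le, Polynomial.zero_le_degree_iff, not_not] at hp
    rw [hp]
    exact I.zero_mem
  | succ n ih =>
    intro p hp hdeg
    have hle : p.degree ≤ n := (Polynomial.degree_le_iff_coeff_zero p n).2 fun m hm =>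
      (Polynomial.degree_lt_iff_coeff_zero p _).1 hdeg m (by exact_mod_cast hm)
    obtain ⟨q, ⟨hq, hqI⟩, hqp⟩ :=
      h n ⟨p, ⟨Polynomial.mem_degreeLE.2 hle, hp⟩, rfl⟩
    rw [← sub_add_cancel p q]
    refine I.add_mem (ih _ (J.sub_mem hp (hIJ hqI)) ?_) hqI
    rw [Polynomial.degree_lt_iff_coeff_zero]
    intro m hm
    rw [Polynomial.coeff_sub]
    rcases hm.eq_or_lt with rfl | hm
    · exact sub_eq_zero.2 hqp.symm
    · rw [coeff_eq_zero_of_degree_lt (hle.trans_lt (by exact_mod_cast hm)),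
        coeff_eq_zero_of_degree_lt ((Polynomial.mem_degreeLE.1 hq).trans_lt (by exact_mod_cast hm)),
        sub_zero]

/-- Hilbert's basis theorem for left Noetherian, not necessarily commutative, rings. -/
theorem Polynomial.isNoetherianRing_of_ring {L : Type*} [Ring L] [IsNoetherianRing L] :
    IsNoetherianRing L[X] := by
  refine monotone_stabilizes_iff_noetherian.1 fun (f : ℕ →o Ideal L[X]) => ?_
  have hstab := fun g => monotone_stabilizes_iff_noetherian.2 (inferInstance : IsNoetherian L L) g
  obtain ⟨n₀, hn₀⟩ := hstab ⟨fun n => (f n).leadingCoeffNth n, fun m n hmn =>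
    (Ideal.leadingCoeffNth_mono_right _ hmn).trans (Ideal.leadingCoeffNth_mono_left (f.mono hmn) _)⟩
  have hsmall := fun n => hstab ⟨fun i => (f i).leadingCoeffNth n, fun i j hij =>
    Ideal.leadingCoeffNth_mono_left (f.mono hij) n⟩
  choose k hk using hsmall
  have hn₀' : ∀ m, n₀ ≤ m → (f n₀).leadingCoeffNth n₀ = (f m).leadingCoeffNth m := hn₀
  have hk' : ∀ n m, k n ≤ m → (f (k n)).leadingCoeffNth n = (f m).leadingCoeffNth n := hk
  let N := max n₀ ((Finset.range n₀).sup k)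
  refine ⟨N, fun m hm => le_antisymm (f.mono hm) (Ideal.le_of_leadingCoeffNth_le (f.mono hm) ?_)⟩
  intro n
  have hN : n₀ ≤ N := le_max_left _ _
  rcases lt_or_ge n n₀ with hn | hn
  · have hkN : k n ≤ N := (Finset.le_sup (Finset.mem_range.2 hn)).trans (le_max_right _ _)
    rw [← hk' n m (hkN.trans hm), hk' n N hkN]
  · calc (f m).leadingCoeffNth n
        ≤ (f (max m n)).leadingCoeffNth (max m n) :=
          (Ideal.leadingCoeffNth_mono_left (f.mono (le_max_left _ _)) _).trans
            (Ideal.leadingCoeffNth_mono_right _ (le_max_right _ _))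
      _ = (f n₀).leadingCoeffNth n₀ := (hn₀' _ (hn.trans (le_max_right _ _))).symm
      _ ≤ (f N).leadingCoeffNth n :=
          (Ideal.leadingCoeffNth_mono_left (f.mono hN) _).trans
            (Ideal.leadingCoeffNth_mono_right _ hn)

/-- A polynomial with value `1` at a central element is not a right zero divisor. -/
theorem Polynomial.eq_zero_of_mul_eq_zero_of_eval {L : Type*} [Ring L] {τ : L}
    (hτ : ∀ a, Commute a τ) {p : L[X]} (hp : p.eval τ = 1) (v : L[X]) (hv : v * p = 0) :
    v = 0 := by
  nontriviality L
  induction hn : v.natDegree using Nat.strong_induction_on generalizing v with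
  | _ n ih =>
    have hq := Polynomial.monic_X_sub_C τ
    have heval : ∀ a b : L[X], (a * b).eval τ = a.eval τ * b.eval τ := fun a b =>
      Polynomial.eval₂_mul_noncomm (RingHom.id L) τ fun k => hτ _
    have h0 : v.eval τ = 0 := by
      have := congrArg (Polynomial.eval τ) hv
      rwa [heval, hp, mul_one, Polynomial.eval_zero] at this
    have hdiv := Polynomial.modByMonic_add_div v (X - C τ)
    have hrem : v %ₘ (X - C τ) = 0 := by
      have hC := Polynomial.eq_C_of_degree_le_zero (p := v %ₘ (X - C τ)) (by
        have := Polynomial.degree_modByMonic_lt v hq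
        rw [Polynomial.degree_X_sub_C] at this
        exact Nat.WithBot.lt_one_iff_le_zero.1 this)
      have := congrArg (Polynomial.eval τ) hdiv
      rw [Polynomial.eval_add, heval, h0, hC] at this
      rw [hC]
      simpa using this
    rw [hrem, zero_add] at hdiv
    by_cases hzero : v.natDegree = 0
    · rw [Polynomial.eq_C_of_natDegree_eq_zero hzero] at h0 ⊢
      rw [Polynomial.eval_C] at h0
      rw [h0, C_0]
    · rw [← hdiv, hq.mul_right_eq_zero_iff]
      refine ih _ ?_ _ ?_ rfl
      · rw [Polynomial.natDegree_divByMonic v hq, Polynomial.natDegree_X_sub_C]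
        omega
      · rw [← hdiv, mul_assoc, hq.mul_right_eq_zero_iff] at hv
        exact hv

/-- The products in a sequence of pairwise coprime monic integral polynomials. -/
noncomputable def coprimeProd : ℕ → ℤ[X]
  | 0 => 1
  | n + 1 => coprimeProd n * (1 + X * coprimeProd n)

theorem monic_one_add_X_mul {p : ℤ[X]} (hp : p.Monic) :
    (1 + X * p).Monic ∧ 0 < (1 + X * p).natDegree := by
  have hX := monic_X.mul hp
  have hdeg : 0 < (X * p).degree := by
    rw [hp.degree_mul, degree_X, Polynomial.degree_eq_natDegree hp.ne_zero]
    exact_mod_cast Nat.add_pos_left one_pos _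
  have hlt : (1 : ℤ[X]).degree < (X * p).degree := by rwa [degree_one]
  refine ⟨hX.add_of_right hlt, ?_⟩
  rw [Polynomial.natDegree_pos_iff_degree_pos, Polynomial.degree_add_eq_right_of_degree_lt hlt]
  exact hdeg

theorem coprimeProd_monic (n : ℕ) : (coprimeProd n).Monic := by
  induction n with
  | zero => exact monic_one
  | succ n ih => exact ih.mul (monic_one_add_X_mul ih).1

/-- Finitely many polynomials over a left Noetherian ring, with value `1` at a central element,
are right regular modulo some central monic polynomial. -/
theorem Polynomial.exists_monic_regular {L : Type*} [Ring L] [IsNoetherianRing L] {τ : L}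
    (hτ : ∀ a, Commute a τ) (s : Finset ℕ) (p : ℕ → L[X]) (hp : ∀ i ∈ s, (p i).eval τ = 1) :
    ∃ χ : ℤ[X], χ.Monic ∧ 0 < χ.natDegree ∧ ∀ i ∈ s, ∀ v w : L[X],
      v * p i = χ.map (Int.castRingHom L) * w → ∃ v', v = χ.map (Int.castRingHom L) * v' := by
  have := Polynomial.isNoetherianRing_of_ring (L := L)
  let W : ℕ → ℕ →o Ideal L[X] := fun i =>
    { toFun := fun j =>
        { carrier := {w | ∃ v, (coprimeProd j).map (Int.castRingHom L) * w = v * p i}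
          zero_mem' := ⟨0, by simp⟩
          add_mem' := by
            rintro a b ⟨v, hv⟩ ⟨v', hv'⟩
            exact ⟨v + v', by rw [mul_add, hv, hv', add_mul]⟩
          smul_mem' := by
            rintro c a ⟨v, hv⟩
            refine ⟨c * v, ?_⟩
            rw [smul_eq_mul, ← mul_assoc, (Polynomial.commute_map_intCast _ c).eq, mul_assoc, hv,
              mul_assoc] }
      monotone' := by
        refine monotone_nat_of_le_succ fun j => ?_
        rintro w ⟨v, hv⟩
        refine ⟨(1 + X * coprimeProd j).map (Int.castRingHom L) * v, ?_⟩
        rw [coprimeProd, Polynomial.map_mul, (Polynomial.commute_map_intCast _ _).eq, mul_assoc, hv,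
          mul_assoc] }
  choose k hk using fun i => monotone_stabilizes_iff_noetherian.2 this (W i)
  let j := s.sup k
  have hj := monic_one_add_X_mul (coprimeProd_monic j)
  refine ⟨1 + X * coprimeProd j, hj.1, hj.2, fun i hi v w hvw => ?_⟩
  set q : L[X] := (1 + X * coprimeProd j).map (Int.castRingHom L) with hq
  have hcomm : ∀ r, Commute q r := Polynomial.commute_map_intCast _
  have hki : k i ≤ j := Finset.le_sup hi
  have hw : w ∈ W i j := by
    rw [← hk i j hki, hk i (j + 1) (by omega)]
    refine ⟨(coprimeProd j).map (Int.castRingHom L) * v, ?_⟩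
    rw [coprimeProd, Polynomial.map_mul, mul_assoc, mul_assoc, hvw]
  obtain ⟨v₁, hv₁⟩ := hw
  have hw' : w = (v - X * v₁) * p i := by
    rw [sub_mul, hvw, mul_assoc, ← hv₁, hq, Polynomial.map_add, Polynomial.map_mul,
      Polynomial.map_one, Polynomial.map_X]
    noncomm_ring
  refine ⟨v - X * v₁, ?_⟩
  rw [← sub_eq_zero]
  refine Polynomial.eq_zero_of_mul_eq_zero_of_eval hτ (hp i hi) _ ?_
  rw [sub_mul, hvw, mul_assoc, ← hw', sub_self]

theorem Polynomial.map_map_intCast {A B : Type*} [Ring A] [Ring B] (χ : ℤ[X]) (f : A →+* B) :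
    (χ.map (Int.castRingHom A)).map f = χ.map (Int.castRingHom B) := by
  rw [Polynomial.map_map, RingHom.eq_intCast' (f.comp _)]

theorem Polynomial.coeff_iterate_map {R : Type*} [Ring R] (f : R →+* R) (n : ℕ) (p : R[X])
    (k : ℕ) : ((Polynomial.map f)^[n] p).coeff k = f^[n] (p.coeff k) := by
  induction n with
  | zero => rfl
  | succ n ih => rw [Function.iterate_succ_apply', Function.iterate_succ_apply', coeff_map, ih]

theorem Polynomial.exists_isPeriodicPt_map {R : Type*} [Ring R] (f : R →+* R)
    (hf : ∀ a, ∃ n, 0 < n ∧ f^[n] a = a) (p : R[X]) :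
    ∃ n, 0 < n ∧ Function.IsPeriodicPt (Polynomial.map f) n p := by
  choose t ht0 ht using hf
  refine ⟨∏ k ∈ p.support, t (p.coeff k), Finset.prod_pos fun k _ => ht0 _, ?_⟩
  refine Polynomial.ext fun k => ?_
  rw [Polynomial.coeff_iterate_map]
  by_cases hk : k ∈ p.support
  · exact Function.IsPeriodicPt.trans_dvd (ht (p.coeff k)) (Finset.dvd_prod_of_mem _ hk)
  · rw [Polynomial.notMem_support_iff.1 hk]
    exact iterate_map_zero f _

theorem TwoSidedIdeal.one_sub_list_prod_mem {A : Type*} [Ring A] (K : TwoSidedIdeal A)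
    (l : List A) (hl : ∀ x ∈ l, 1 - x ∈ K) : 1 - l.prod ∈ K := by
  induction l with
  | nil => simp
  | cons x l ih =>
    have h1 := hl x (by simp)
    have h2 := ih fun y hy => hl y (by simp [hy])
    have := K.add_mem h1 (K.mul_mem_left x _ h2)
    rw [List.prod_cons]
    convert this using 1
    noncomm_ring

/-- A periodic element `a` with `φ(a) = 1` can be replaced by an element all of whose conjugates
have image `1` under `φ`. -/
theorem exists_isPeriodicPt_forall_map_eq_one {A L : Type*} [Ring A] [Ring L] (s : A →+* A)
    (φ : A →+* L) (K : TwoSidedIdeal A) (hK : ∀ a ∈ K, s a ∈ K) {a : A} (ha : a ∈ K)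
    (hφ : φ a = 1) {m : ℕ} (hm : 0 < m) (hper : Function.IsPeriodicPt s m a) :
    ∃ b ∈ K, Function.IsPeriodicPt s m b ∧ ∀ n, φ (s^[n] b) = 1 := by
  have hiter : ∀ j, s^[j] a ∈ K := by
    intro j
    induction j with
    | zero => exact ha
    | succ j ih => rw [Function.iterate_succ_apply']; exact hK _ ih
  have hpush : ∀ n, s^[n] (1 - ((List.range m).map fun j => 1 - s^[j] a).prod) =
      1 - ((List.range m).map fun j => 1 - s^[j] (s^[n] a)).prod := by
    intro n
    rw [← RingHom.coe_pow, map_sub, map_one, map_list_prod, List.map_map]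
    congr 3
    funext j
    rw [Function.comp_apply, map_sub, map_one, RingHom.coe_pow, ← Function.iterate_add_apply, ← Function.iterate_add_apply, add_comm]
  refine ⟨1 - ((List.range m).map fun j => 1 - s^[j] a).prod, ?_, ?_, fun n => ?_⟩
  · refine K.one_sub_list_prod_mem _ fun x hx => ?_
    obtain ⟨j, -, rfl⟩ := List.mem_map.1 hx
    rw [sub_sub_cancel]
    exact hiter j
  · rw [Function.IsPeriodicPt, Function.IsFixedPt, hpush, hper]
  · rw [hpush, map_sub, map_one, map_list_prod, List.prod_eq_zero, sub_zero]
    have hlt := Nat.mod_lt n hm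
    refine List.mem_map.2 ⟨_, List.mem_map.2
      ⟨(m - n % m) % m, List.mem_range.2 (Nat.mod_lt _ hm), rfl⟩, ?_⟩
    rw [map_sub, map_one, ← Function.iterate_add_apply, ← hper.iterate_mod_apply]
    have : ((m - n % m) % m + n) % m = 0 := by
      rw [Nat.mod_add_mod, Nat.add_mod_eq_add_mod_left _ (Nat.mod_mod n m).symm,
        Nat.sub_add_cancel hlt.le, Nat.mod_self]
    rw [this, Function.iterate_zero_apply, hφ, sub_self]

/-- The polynomials all of whose coefficients lie in the Jacobson radical. -/
noncomputable def jacobsonPolynomial (S : Type*) [Ring S] : TwoSidedIdeal S[X] :=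
  TwoSidedIdeal.mk' {p | ∀ n, p.coeff n ∈ Ring.jacobson S}
    (fun n => by simp)
    (fun hp hq n => by rw [coeff_add]; exact add_mem (hp n) (hq n))
    (fun hp n => by rw [coeff_neg]; exact neg_mem (hp n))
    (fun hq n => by
      rw [coeff_mul]
      exact sum_mem fun i _ => Ideal.mul_mem_left _ _ (hq _))
    (fun hp n => by
      rw [coeff_mul]
      exact sum_mem fun i _ => Ideal.mul_mem_right _ _ (hp _))

theorem mem_jacobsonPolynomial {S : Type*} [Ring S] {p : S[X]} :
    p ∈ jacobsonPolynomial S ↔ ∀ n, p.coeff n ∈ Ring.jacobson S :=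
  TwoSidedIdeal.mem_mk' ..

theorem IsOreExtension.isNilpotent_of_mem_jacobson {R S : Type*} [Ring R] [Ring S]
    {σ D : R → R} {ι : R → S} {X : S} (h : IsOreExtension σ D ι X) (hσ : Function.Surjective σ)
    (hPI : SatisfiesPolynomialIdentity R) (htor : ∀ a : R, ∃ n : ℕ, 0 < n ∧ σ^[n] a = a)
    {c : R} (hc : ι c ∈ Ring.jacobson S) : IsNilpotent c := by
  by_contra hnil
  obtain ⟨d, F, hF⟩ := hPI.exists_isMultilinearIdentity
  obtain ⟨L, _, φ, a, _, _, hφ, hφa, ha⟩ := exists_noetherian_quotient_of_not_isNilpotent hF hnil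
  have hp := h.polynomial
  have hs : Function.Surjective (Polynomial.map h.twistHom) := Polynomial.map_surjective _ hσ
  let K := hp.leadIdeal hs (jacobsonPolynomial S)
  have haK : a ∈ K := by
    refine ha K (hp.mem_leadIdeal_of_ι_mem hs _ ?_)
    rw [Polynomial.map_C, mem_jacobsonPolynomial]
    intro n
    rw [Polynomial.coeff_C]
    split_ifs
    · exact hc
    · exact zero_mem _
  obtain ⟨m, hm, hper⟩ := Polynomial.exists_isPeriodicPt_map h.twistHom htor a
  obtain ⟨b, hbK, hbper, hb⟩ := exists_isPeriodicPt_forall_map_eq_one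
    (Polynomial.mapRingHom h.twistHom) φ K (fun _ => hp.σ_mem_leadIdeal hs _) haK hφa hm hper
  rw [Polynomial.coe_mapRingHom] at hbper hb
  let ψ : R →+* L := φ.comp C
  have hτ : ∀ l, Commute l (φ Polynomial.X) := by
    intro l
    obtain ⟨p, rfl⟩ := hφ l
    exact (Polynomial.commute_X p).symm.map φ
  obtain ⟨χ, hχ, hχdeg, hreg⟩ := Polynomial.exists_monic_regular hτ (Finset.range m)
    (fun n => ((Polynomial.map h.twistHom)^[n] b).map ψ) (by
      intro n _
      rw [Polynomial.eval_map, ← Polynomial.hom_eval₂, Polynomial.eval₂_C_X, hb])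
  set q : L[X] := χ.map (Int.castRingHom L)
  let P : AddSubgroup R[X] :=
    { carrier := {r | ∃ w, r.map ψ = q * w}
      zero_mem' := ⟨0, by simp⟩
      add_mem' := by
        rintro x y ⟨w, hw⟩ ⟨w', hw'⟩
        exact ⟨w + w', by rw [Polynomial.map_add, hw, hw', mul_add]⟩
      neg_mem' := by
        rintro x ⟨w, hw⟩
        exact ⟨-w, by rw [Polynomial.map_neg, hw, mul_neg]⟩ }
  have hPmul : ∀ x ∈ P, ∀ r, x * r ∈ P := by
    rintro x ⟨w, hw⟩ r
    exact ⟨w * r.map ψ, by rw [Polynomial.map_mul, hw, mul_assoc]⟩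
  have hP1 : (1 : R[X]) ∉ P := by
    rintro ⟨w, hw⟩
    rw [Polynomial.map_one] at hw
    have hw0 : w ≠ 0 := by
      rintro rfl
      simp at hw
    have := congrArg Polynomial.natDegree hw
    rw [(hχ.map _).natDegree_mul' hw0, hχ.natDegree_map, Polynomial.natDegree_one] at this
    omega
  obtain ⟨d₀, hd₀⟩ := (hp.mem_leadIdeal hs _).1 hbK
  obtain ⟨G, hG, hlead⟩ := hd₀ (d₀ + 1) (by omega)
  obtain ⟨u, v, huv⟩ := Polynomial.exists_mul_one_sub_eq (mem_jacobsonPolynomial.1 hG) hχ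
  refine hp.not_left_inverse_of_hasLead hPmul hP1 (Nat.succ_pos d₀) hlead ?_ ?_ huv
  · rintro n x ⟨w, hw⟩
    rw [← hbper.iterate_mod_apply, Polynomial.map_mul] at hw
    exact hreg (n % m) (Finset.mem_range.2 (Nat.mod_lt _ hm)) _ _ hw
  · intro n
    rw [← χ.map_map_intCast h.coeffHom, hp.coeffs_ι_mul]
    exact ⟨_, by rw [Polynomial.map_mul, Polynomial.map_map_intCast]⟩

end

/-- If `R` is a PI-ring, `σ` is a locally torsion automorphism of `R` and `D` is a
`σ`-derivation, then `J(R[x;σ,D]) ∩ R` is a nil (two-sided) ideal of `R`. -/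
theorem jacobson_cap_nil_of_PI {R S : Type*} [Ring R] [Ring S]
    (σ D : R → R) (ι : R → S) (X : S)
    (hOre : IsOreExtension σ D ι X) (hσ : Function.Bijective σ)
    (hPI : SatisfiesPolynomialIdentity R)
    (htor : ∀ a : R, ∃ n : ℕ, 0 < n ∧ σ^[n] a = a) :
    ∃ I : TwoSidedIdeal R,
      (∀ r : R, r ∈ I ↔ ι r ∈ (⊥ : Ideal S).jacobson) ∧ ∀ r ∈ I, IsNilpotent r := by
  rw [Ideal.jacobson_bot]
  have hmem : ∀ r : R, r ∈ (Ring.jacobson S).toTwoSided.comap hOre.coeffHom ↔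
      ι r ∈ Ring.jacobson S := fun r => by
    rw [TwoSidedIdeal.mem_comap, Ideal.mem_toTwoSided]
    rfl
  exact ⟨_, hmem, fun r hr =>
    hOre.isNilpotent_of_mem_jacobson hσ.surjective hPI htor ((hmem r).1 hr)⟩
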